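/- Let A be a unital commutative ℝ-algebra generated by a linear subspace V ⊆ A, K ⊆ X(A) closed, L a normalized linear functional on A with L(∑A²) ⊆ [0,∞), and Q a quadratic module in A with K = K_Q. Suppose there exists a Hilbertian seminorm q on V such that tr(s_L|_V / q) < ∞ and {α ∈ K : α|_V is q-continuous} ≠ ∅, and suppose that for each S ∈ J there exists a representing Radon measure ν_S for L|_S with support contained in K_{Q∩S}. Then there exists a representing Radon measure for L with support contained in {α ∈ K : α|_V is q-continuous}. -/

import Mathlib

open MeasureTheory
open scoped ENNReal

noncomputable section

/-- The character space `X(A)` of a unital commutative `ℝ`-algebra `A`: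
the set of `ℝ`-algebra homomorphisms `A → ℝ`. -/
abbrev Character (A : Type*) [CommRing A] [Algebra ℝ A] := A →ₐ[ℝ] ℝ

/-- The weak topology on the character space: the weakest topology making all
evaluations `α ↦ α a` continuous. -/
instance Character.instTopologicalSpace (A : Type*) [CommRing A] [Algebra ℝ A] :
    TopologicalSpace (Character A) :=
  TopologicalSpace.induced (fun (α : Character A) (a : A) => α a) inferInstance

/-- The Borel σ-algebra on the character space. -/
instance Character.instMeasurableSpace (A : Type*) [CommRing A] [Algebra ℝ A] :
    MeasurableSpace (Character A) :=
  borel (Character A)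

/-- A Radon measure: a locally finite Borel measure that is inner regular with
respect to compact sets. -/
def IsRadonMeasure {X : Type*} [TopologicalSpace X] [MeasurableSpace X]
    (μ : Measure X) : Prop :=
  IsLocallyFiniteMeasure μ ∧ μ.InnerRegularWRT IsCompact MeasurableSet

/-- A Hilbertian seminorm on a real vector space `V`: a seminorm induced by a
symmetric positive semidefinite bilinear form, recorded by the form itself. -/
structure HilbSeminorm (V : Type*) [AddCommGroup V] [Module ℝ V] where
  bilin : V →ₗ[ℝ] V →ₗ[ℝ] ℝ
  symm : ∀ v w, bilin v w = bilin w v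
  nonneg : ∀ v, 0 ≤ bilin v v

namespace HilbSeminorm

variable {V W : Type*} [AddCommGroup V] [Module ℝ V] [AddCommGroup W] [Module ℝ W]

/-- The seminorm associated to a Hilbertian seminorm: `p v = √⟨v,v⟩ₚ`. -/
def toFun (p : HilbSeminorm V) (v : V) : ℝ := Real.sqrt (p.bilin v v)

/-- Pullback of a Hilbertian seminorm along a linear map (e.g. restriction to a
subspace along the inclusion). -/
def comp (p : HilbSeminorm V) (f : W →ₗ[ℝ] V) : HilbSeminorm W where
  bilin := LinearMap.compl₁₂ p.bilin f f
  symm v w := by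
    simp only [LinearMap.compl₁₂_apply]
    exact p.symm (f v) (f w)
  nonneg v := by
    simp only [LinearMap.compl₁₂_apply]
    exact p.nonneg (f v)

/-- The Hilbertian seminorm `c • p`, induced by the bilinear form `c² ⟨·,·⟩ₚ`. -/
def smul (p : HilbSeminorm V) (c : ℝ) : HilbSeminorm V where
  bilin := c ^ 2 • p.bilin
  symm v w := by
    simp only [LinearMap.smul_apply, smul_eq_mul]
    rw [p.symm v w]
  nonneg v := by
    simp only [LinearMap.smul_apply, smul_eq_mul]
    exact mul_nonneg (sq_nonneg c) (p.nonneg v)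

/-- A finite subset `E ⊆ V` is `q`-orthonormal. -/
def IsONS (q : HilbSeminorm V) (E : Finset V) : Prop :=
  (∀ e ∈ E, q.bilin e e = 1) ∧ ∀ e ∈ E, ∀ f ∈ E, e ≠ f → q.bilin e f = 0

open scoped Classical

/-- The trace `tr(p/q)` of a Hilbertian seminorm `p` with respect to a Hilbertian
seminorm `q`: the supremum over finite `q`-orthonormal sets `E` of `∑_{e∈E} p(e)²`
if `ker q ⊆ ker p`, and `∞` otherwise. -/
def trace (p q : HilbSeminorm V) : ℝ≥0∞ :=
  if ∀ v, q.bilin v v = 0 → p.bilin v v = 0 then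
    ⨆ (E : Finset V) (_ : q.IsONS E), ENNReal.ofReal (∑ e ∈ E, p.bilin e e)
  else ⊤

end HilbSeminorm

section AlgebraDefs

variable {A : Type*} [CommRing A] [Algebra ℝ A]

/-- The restriction `α|_V` of a character `α` is `q`-continuous. -/
def QContOn (V : Submodule ℝ A) (q : ↥V → ℝ) (α : Character A) : Prop :=
  ∃ C > 0, ∀ v : V, |α (v : A)| ≤ C * q v

/-- `J`: the family of all subalgebras of `A` generated by finite-dimensional
subspaces of `V`. -/
def finGenSubalgebras (V : Submodule ℝ A) : Set (Subalgebra ℝ A) :=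
  {S | ∃ W : Submodule ℝ A, W ≤ V ∧ FiniteDimensional ℝ ↥W ∧
    S = Algebra.adjoin ℝ (W : Set A)}

/-- The family `{ν_S : S ∈ J}` is `p`-concentrated. -/
def Concentrated (V : Submodule ℝ A) (J : Set (Subalgebra ℝ A)) (p : ↥V → ℝ)
    (ν : ∀ S : Subalgebra ℝ A, Measure (Character ↥S)) : Prop :=
  ∀ ε > (0 : ℝ), ∃ δ > (0 : ℝ), ∀ S ∈ J, ∀ v : V, ∀ hv : (v : A) ∈ S,
    p v ≤ δ → ν S {α : Character ↥S | 1 ≤ |α ⟨(v : A), hv⟩|} ≤ ENNReal.ofReal ε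

/-- A quadratic module in `A`. -/
def IsQuadraticModule (Q : Set A) : Prop :=
  (1 : A) ∈ Q ∧ (∀ x ∈ Q, ∀ y ∈ Q, x + y ∈ Q) ∧ ∀ a : A, ∀ x ∈ Q, a ^ 2 * x ∈ Q

/-- The nonnegativity set `K_Q ⊆ X(A)` of a quadratic module `Q`. -/
def charNonneg (Q : Set A) : Set (Character A) := {α | ∀ a ∈ Q, 0 ≤ α a}

/-- The nonnegativity set `K_{Q ∩ S} ⊆ X(S)` for a subalgebra `S`. -/
def charNonnegOn (Q : Set A) (S : Subalgebra ℝ A) : Set (Character ↥S) :=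
  {α | ∀ a : S, (a : A) ∈ Q → 0 ≤ α a}

/-- The Hilbertian seminorm `s_L(a) = √(L(a²))` induced by a `∑A²`-positive
linear functional `L`, via the bilinear form `(a,b) ↦ L(ab)`. -/
def sLSeminorm (L : A →ₗ[ℝ] ℝ) (hL : ∀ a : A, 0 ≤ L (a * a)) : HilbSeminorm A where
  bilin := (LinearMap.mul ℝ A).compr₂ L
  symm v w := by simp [mul_comm]
  nonneg v := by simpa using hL v

end AlgebraDefs

/-- `τ` is the topology induced by a directed family `P` of Hilbertian
seminorms. -/
def InducedByHilbFamily {V : Type*} [AddCommGroup V] [Module ℝ V]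
    (τ : TopologicalSpace V) (P : Set (HilbSeminorm V)) : Prop :=
  (∀ p ∈ P, ∀ q ∈ P, ∃ r ∈ P, ∀ v, p.toFun v ≤ r.toFun v ∧ q.toFun v ≤ r.toFun v) ∧
  ∀ v : V, (@nhds V τ v).HasBasis
    (fun pe : HilbSeminorm V × ℝ => pe.1 ∈ P ∧ 0 < pe.2)
    (fun pe => {w | pe.1.toFun (w - v) < pe.2})

/-- A topology is nuclear (in the sense of Yamasaki) if it is induced by a
directed family `P` of Hilbertian seminorms such that every `p ∈ P` admits
`q ∈ P` with `tr(p/q) < ∞`. -/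
def IsNuclearTopology {V : Type*} [AddCommGroup V] [Module ℝ V]
    (τ : TopologicalSpace V) : Prop :=
  ∃ P : Set (HilbSeminorm V), InducedByHilbFamily τ P ∧
    ∀ p ∈ P, ∃ q ∈ P, p.trace q < ⊤

end

open Filter Topology Set


/-- Along an ultrafilter, the laws of continuous random elements of a compact Hausdorff space
converge weakly to a regular probability measure. -/
theorem exists_regular_ultralimit {ι Z : Type*} [TopologicalSpace Z] [CompactSpace Z] [T2Space Z]
    [MeasurableSpace Z] [BorelSpace Z] (U : Ultrafilter ι) {Ω : ι → Type*}
    [∀ i, TopologicalSpace (Ω i)] [∀ i, MeasurableSpace (Ω i)] [∀ i, BorelSpace (Ω i)]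
    (P : ∀ i, Measure (Ω i)) [∀ i, IsProbabilityMeasure (P i)]
    (Y : ∀ i, Ω i → Z) (hY : ∀ i, Continuous (Y i)) :
    ∃ μ : Measure Z, IsProbabilityMeasure μ ∧ μ.Regular ∧
      ∀ f : C(Z, ℝ), Tendsto (fun i => ∫ ω, f (Y i ω) ∂(P i)) U (𝓝 (∫ z, f z ∂μ)) := by
  let m : ι → ProbabilityMeasure Z := fun i =>
    ⟨(P i).map (Y i), Measure.isProbabilityMeasure_map (hY i).aemeasurable⟩
  obtain ⟨μ₀, -, hμ₀⟩ := isCompact_univ.ultrafilter_le_nhds' (U.map m) univ_mem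
  have hlim : Tendsto m U (𝓝 μ₀) := hμ₀
  rw [ProbabilityMeasure.tendsto_iff_forall_integral_tendsto] at hlim
  obtain ⟨μ, hreg, hfin, hμ⟩ := Measure.exists_regular_eq_of_compactSpace (μ₀ : Measure Z)
  have hprob : IsProbabilityMeasure μ := by
    have h := hμ 1
    simp only [BoundedContinuousFunction.coe_one, Pi.one_apply, integral_const, smul_eq_mul,
      mul_one, probReal_univ] at h
    exact ⟨by rw [← ENNReal.toReal_eq_one_iff]; exact h.symm⟩
  refine ⟨μ, hprob, hreg, fun f => ?_⟩
  have h := hlim (BoundedContinuousFunction.mkOfCompact f)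
  rw [hμ] at h
  refine h.congr fun i => ?_
  exact integral_map (hY i).aemeasurable
    (BoundedContinuousFunction.mkOfCompact f).continuous.aestronglyMeasurable

/-- If selections from sets of mass at least `1 - ε` have all their limits in the closed set `F`,
then a weak limit gives `F` mass at least `1 - ε`. -/
theorem measure_compl_le_of_ultralimit {ι Z : Type*} [TopologicalSpace Z] [CompactSpace Z]
    [T2Space Z] [MeasurableSpace Z] [BorelSpace Z] (U : Ultrafilter ι) {Ω : ι → Type*}
    [∀ i, TopologicalSpace (Ω i)] [∀ i, MeasurableSpace (Ω i)] [∀ i, BorelSpace (Ω i)]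
    (P : ∀ i, Measure (Ω i)) [∀ i, IsProbabilityMeasure (P i)]
    (Y : ∀ i, Ω i → Z) (hY : ∀ i, Continuous (Y i))
    (μ : Measure Z) [IsProbabilityMeasure μ] [μ.Regular]
    (hμ : ∀ f : C(Z, ℝ), Tendsto (fun i => ∫ ω, f (Y i ω) ∂(P i)) U (𝓝 (∫ z, f z ∂μ)))
    {F : Set Z} (hF : IsClosed F) (G : ∀ i, Set (Ω i)) {ε : ℝ} (hε : 0 ≤ ε)
    (hG : ∀ i, P i (G i)ᶜ ≤ ENNReal.ofReal ε)
    (hlim : ∀ ω : ∀ i, Ω i, (∀ᶠ i in U, ω i ∈ G i) → ∀ z,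
      Tendsto (fun i => Y i (ω i)) U (𝓝 z) → z ∈ F) :
    μ Fᶜ ≤ ENNReal.ofReal ε := by
  rw [hF.isOpen_compl.measure_eq_iSup_isCompact]
  refine iSup₂_le fun C hCF => iSup_le fun hC => ?_
  obtain ⟨f, hfF, hfC, hf01⟩ := exists_continuous_zero_one_of_isClosed hF hC.isClosed
    (disjoint_right.2 fun x hx => hCF hx)
  have hsmall : ∀ δ > 0, ∀ᶠ i in U, ∀ ω ∈ G i, f (Y i ω) < δ := by
    intro δ hδ
    by_contra hcon
    have hfreq : ∀ᶠ i in U, ∃ ω ∈ G i, δ ≤ f (Y i ω) := by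
      rw [← Ultrafilter.eventually_not] at hcon
      filter_upwards [hcon] with i hi
      push Not at hi
      exact hi
    have hne : ∀ i, Nonempty (Ω i) := fun i => (inferInstance : NeZero (P i)).out |>
      fun h => by
        by_contra hcon
        rw [not_nonempty_iff] at hcon
        exact h (Measure.eq_zero_of_isEmpty _)
    have hsel : ∀ i, ∃ ω : Ω i, (∃ ω ∈ G i, δ ≤ f (Y i ω)) → ω ∈ G i ∧ δ ≤ f (Y i ω) := by
      intro i
      by_cases h : ∃ ω ∈ G i, δ ≤ f (Y i ω)
      · obtain ⟨ω, hω⟩ := h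
        exact ⟨ω, fun _ => hω⟩
      · exact ⟨(hne i).some, fun h' => absurd h' h⟩
    choose ω hω using hsel
    have hω' := hfreq.mono fun i hi => hω i hi
    obtain ⟨z, -, hz⟩ := isCompact_univ.ultrafilter_le_nhds' (U.map fun i => Y i (ω i)) univ_mem
    have hz' : Tendsto (fun i => Y i (ω i)) U (𝓝 z) := hz
    have hzF := hlim ω (hω'.mono fun i hi => hi.1) z hz'
    have hge : δ ≤ f z := ge_of_tendsto ((f.continuous.tendsto z).comp hz')
      (hω'.mono fun i hi => hi.2)
    rw [hfF hzF] at hge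
    exact absurd hge (not_le.2 hδ)
  have hint : ∫ z, f z ∂μ ≤ ε := by
    refine le_of_forall_pos_le_add fun δ hδ => ?_
    refine le_of_tendsto (hμ f) ?_
    filter_upwards [hsmall δ hδ] with i hi
    set B := toMeasurable (P i) (G i)ᶜ
    have hB : MeasurableSet B := measurableSet_toMeasurable _ _
    have hfi : Integrable (fun ω => f (Y i ω)) (P i) := by
      refine Integrable.of_bound (C := 1)
        (f.continuous.comp (hY i)).measurable.aestronglyMeasurable (ae_of_all _ fun ω => ?_)
      rw [Real.norm_eq_abs, abs_of_nonneg (hf01 _).1]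
      exact (hf01 _).2
    calc ∫ ω, f (Y i ω) ∂(P i)
        ≤ ∫ ω, (B.indicator (fun _ => (1 : ℝ)) ω + δ) ∂(P i) := by
          refine integral_mono hfi
            (((integrable_const _).indicator hB).add (integrable_const _)) fun ω => ?_
          by_cases hω : ω ∈ G i
          · have h0 : 0 ≤ B.indicator (fun _ => (1 : ℝ)) ω :=
              indicator_nonneg (fun _ _ => zero_le_one) _
            have := hi ω hω
            dsimp only
            linarith
          · have hωB : ω ∈ B := subset_toMeasurable _ _ hω
            have := (hf01 (Y i ω)).2
            simp only [indicator_of_mem hωB]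
            linarith
      _ = (P i).real B + δ := by
          rw [integral_add ((integrable_const _).indicator hB) (integrable_const _),
            integral_indicator hB]
          simp
      _ ≤ ε + δ := by
          gcongr
          rw [Measure.real, measure_toMeasurable]
          exact ENNReal.toReal_le_of_le_ofReal hε (hG i)
  have hfμ : Integrable f μ := f.continuous.integrable_of_hasCompactSupport
    (HasCompactSupport.of_compactSpace _)
  have hC' : μ.real C ≤ ε := by
    refine le_trans ?_ hint
    rw [← integral_indicator_one hC.measurableSet]
    refine integral_mono ((integrable_const _).indicator hC.measurableSet) hfμ fun z => ?_
    by_cases hz : z ∈ C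
    · simp [hz, hfC hz]
    · simpa [hz] using (hf01 z).1
  rw [← ofReal_measureReal]
  exact ENNReal.ofReal_le_ofReal hC'



/-- A regular probability measure on a compact space that is carried by a countable union of
compact subsets of an embedded space comes from a Radon measure on that space. -/
theorem exists_isRadonMeasure_map_eq {X Z : Type*} [TopologicalSpace X] [MeasurableSpace X]
    [BorelSpace X] [Nonempty X] [TopologicalSpace Z] [CompactSpace Z] [T2Space Z]
    [MeasurableSpace Z] [BorelSpace Z] {φ : X → Z} (hφ : IsEmbedding φ)
    (μ : Measure Z) [IsProbabilityMeasure μ] [μ.Regular]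
    (K : ℕ → Set X) (hK : ∀ n, IsCompact (K n)) {ε : ℕ → ℝ} (hε : Tendsto ε atTop (𝓝 0))
    (hμK : ∀ n, μ (φ '' K n)ᶜ ≤ ENNReal.ofReal (ε n)) :
    ∃ ν : Measure X, IsProbabilityMeasure ν ∧ IsRadonMeasure ν ∧ ν.map φ = μ ∧
      ν (⋃ n, K n)ᶜ = 0 := by
  have hKZ : ∀ n, MeasurableSet (φ '' K n) := fun n =>
    ((hK n).image hφ.continuous).isClosed.measurableSet
  set T : Set Z := ⋃ n, φ '' K n with hT
  have hTm : MeasurableSet T := MeasurableSet.iUnion hKZ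
  have hTnull : μ Tᶜ = 0 := by
    have hlim : Tendsto (fun n => ENNReal.ofReal (ε n)) atTop (𝓝 0) := by
      simpa using ENNReal.tendsto_ofReal hε
    refine le_antisymm (ge_of_tendsto' hlim fun n => ?_) zero_le
    exact (measure_mono (compl_subset_compl.2 (subset_iUnion _ n))).trans (hμK n)
  have hTrange : T ⊆ range φ := iUnion_subset fun n => image_subset_range _ _
  have hTae : ∀ᵐ z ∂μ, z ∈ T := hTnull
  have hinv : ∀ z ∈ T, φ (Function.invFun φ z) = z := fun z hz =>
    Function.invFun_eq (hTrange hz)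
  classical
  let x₀ : X := Classical.arbitrary X
  let ψ : Z → X := fun z => if z ∈ T then Function.invFun φ z else x₀
  have hψ : ∀ z ∈ T, φ (ψ z) = z := fun z hz => by simp only [ψ, if_pos hz, hinv z hz]
  have hψφ : ∀ x, φ x ∈ T → ψ (φ x) = x := fun x hx => hφ.injective (hψ _ hx)
  have hψm : Measurable ψ := by
    have hX : ‹MeasurableSpace X› = MeasurableSpace.comap φ ‹MeasurableSpace Z› := by
      rw [BorelSpace.measurable_eq (α := X), BorelSpace.measurable_eq (α := Z), hφ.eq_induced,
        borel_comap]
    intro B hB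
    rw [hX] at hB
    obtain ⟨B', hB', rfl⟩ := hB
    have : ψ ⁻¹' (φ ⁻¹' B') = (T ∩ B') ∪ (Tᶜ ∩ {_z | φ x₀ ∈ B'}) := by
      ext z
      by_cases hz : z ∈ T
      · simp [hz, hψ z hz]
      · simp [hz, ψ]
    rw [this]
    exact (hTm.inter hB').union (hTm.compl.inter (MeasurableSet.const _))
  have hφm : Measurable φ := hφ.continuous.measurable
  have hKX : ∀ n, K n = φ ⁻¹' (φ '' K n) := fun n => (preimage_image_eq _ hφ.injective).symm
  have hmap : (μ.map ψ).map φ = μ := by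
    rw [Measure.map_map hφm hψm]
    conv_rhs => rw [← Measure.map_id (μ := μ)]
    exact Measure.map_congr (hTae.mono fun z hz => hψ z hz)
  have hprob : IsProbabilityMeasure (μ.map ψ) := Measure.isProbabilityMeasure_map hψm.aemeasurable
  have hTX : (⋃ n, K n) = φ ⁻¹' T := by
    rw [hT, preimage_iUnion]
    exact iUnion_congr hKX
  have hnull : (μ.map ψ) (⋃ n, K n)ᶜ = 0 := by
    rw [hTX, ← preimage_compl, ← Measure.map_apply hφm hTm.compl, hmap, hTnull]
  refine ⟨μ.map ψ, hprob, ⟨inferInstance, ?_⟩, hmap, hnull⟩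
  intro B hB r hr
  rw [Measure.map_apply hψm hB] at hr
  have hr' : r < μ (ψ ⁻¹' B ∩ T) := by
    rwa [measure_inter_conull hTnull]
  obtain ⟨F, hFB, hF, hrF⟩ :=
    ((hψm hB).inter hTm).exists_lt_isCompact hr'
  refine ⟨φ ⁻¹' F, fun x hx => ?_, ?_, ?_⟩
  · have := hFB hx
    rw [← hψφ x this.2]
    exact this.1
  · rw [hφ.isCompact_iff, image_preimage_eq_of_subset fun z hz => hTrange (hFB hz).2]
    exact hF
  · rwa [← Measure.map_apply hφm hF.isClosed.measurableSet, hmap]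


/-- Truncation of a real number to the interval `[-R, R]`. -/
noncomputable def clip (R x : ℝ) : ℝ := max (-R) (min R x)

theorem continuous_clip (R : ℝ) : Continuous (clip R) := by
  unfold clip
  fun_prop

theorem abs_clip_le_abs {R : ℝ} (hR : 0 ≤ R) (x : ℝ) : |clip R x| ≤ |x| := by
  unfold clip
  rcases le_total R x with h | h
  · rw [min_eq_left h, max_eq_right (by linarith), abs_of_nonneg hR]
    exact h.trans (le_abs_self x)
  · rw [min_eq_right h]
    rcases le_total (-R) x with h' | h'
    · rw [max_eq_right h']
    · rw [max_eq_left h', abs_neg, abs_of_nonneg hR]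
      exact (by linarith : R ≤ -x).trans (neg_le_abs x)

theorem abs_clip_le {R : ℝ} (hR : 0 ≤ R) (x : ℝ) : |clip R x| ≤ R := by
  rw [abs_le]
  exact ⟨le_max_left _ _, max_le (by linarith) (min_le_left _ _)⟩

theorem clip_of_abs_le {R x : ℝ} (h : |x| ≤ R) : clip R x = x := by
  unfold clip
  rw [abs_le] at h
  rw [min_eq_right h.2, max_eq_right h.1]

theorem mul_abs_sub_clip_le {R : ℝ} (hR : 0 ≤ R) (x : ℝ) : R * |x - clip R x| ≤ x ^ 2 := by
  rcases le_or_gt |x| R with h | h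
  · rw [clip_of_abs_le h]
    simpa using sq_nonneg x
  · have h1 : |x - clip R x| ≤ |x| := by
      unfold clip
      rcases le_total R x with h' | h'
      · rw [min_eq_left h', max_eq_right (by linarith), abs_of_nonneg (by linarith),
          abs_of_nonneg (by linarith)]
        linarith
      · have hx : x ≤ -R := by
          by_contra hcon
          exact absurd (abs_le.2 ⟨(not_le.1 hcon).le, h'⟩) (not_le.2 h)
        rw [min_eq_right h', max_eq_left hx, abs_of_nonpos (by linarith),
          abs_of_nonpos (by linarith)]
        linarith
    calc R * |x - clip R x| ≤ |x| * |x| := by gcongr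
      _ = x ^ 2 := by rw [← sq, sq_abs]

/-- Truncation to `[-R, R]` extended to the extended reals. -/
noncomputable def ERealClip (R : ℝ) (x : EReal) : ℝ := (max ((-R : ℝ) : EReal) (min (R : EReal) x)).toReal

theorem continuous_ERealClip (R : ℝ) : Continuous (ERealClip R) := by
  refine EReal.continuousOn_toReal.comp_continuous (by fun_prop) fun x => ?_
  simp only [mem_compl_iff, mem_insert_iff, mem_singleton_iff, not_or]
  refine ⟨fun h => ?_, fun h => ?_⟩
  · exact absurd (h ▸ le_max_left ((-R : ℝ) : EReal) _ : ((-R : ℝ) : EReal) ≤ ⊥)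
      (not_le.2 (EReal.bot_lt_coe _))
  · have h1 : max ((-R : ℝ) : EReal) (min (R : EReal) x) < ⊤ :=
      max_lt (EReal.coe_lt_top _) ((min_le_left _ _).trans_lt (EReal.coe_lt_top _))
    exact h1.ne h

theorem ERealClip_coe (R x : ℝ) : ERealClip R (x : EReal) = clip R x := by
  unfold ERealClip clip
  rw [← EReal.coe_strictMono.monotone.map_min, ← EReal.coe_strictMono.monotone.map_max,
    EReal.toReal_coe]

/-- Means pass to the limit for random variables with bounded second moments whose truncations
converge in mean. -/
theorem integral_eq_of_tendsto_integral_clip {ι X : Type*} [MeasurableSpace X] (U : Filter ι)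
    [U.NeBot] {Ω : ι → Type*} [∀ i, MeasurableSpace (Ω i)]
    (P : ∀ i, Measure (Ω i)) [∀ i, IsProbabilityMeasure (P i)]
    (ν : Measure X) [IsProbabilityMeasure ν] (h : X → ℝ) (hh : Measurable h)
    (Y : ∀ i, Ω i → ℝ) (m M : ℝ)
    (hY : ∀ᶠ i in U, Integrable (Y i) (P i) ∧ ∫ ω, Y i ω ∂(P i) = m ∧
      Integrable (fun ω => Y i ω ^ 2) (P i) ∧ ∫ ω, Y i ω ^ 2 ∂(P i) = M)
    (hclip : ∀ R, 0 ≤ R →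
      Tendsto (fun i => ∫ ω, clip R (Y i ω) ∂(P i)) U (𝓝 (∫ x, clip R (h x) ∂ν)))
    (hclip' : ∀ R, 0 ≤ R →
      Tendsto (fun i => ∫ ω, |clip R (Y i ω)| ∂(P i)) U (𝓝 (∫ x, |clip R (h x)| ∂ν))) :
    m = ∫ x, h x ∂ν := by
  have hcm : ∀ R, Measurable fun x => clip R (h x) := fun R => (continuous_clip R).measurable.comp hh
  have hclim : ∀ x, Tendsto (fun n : ℕ => clip n (h x)) atTop (𝓝 (h x)) := fun x => by
    refine tendsto_const_nhds.congr' ?_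
    filter_upwards [eventually_ge_atTop ⌈|h x|⌉₊] with n hn
    exact (clip_of_abs_le ((Nat.le_ceil _).trans (by exact_mod_cast hn))).symm
  have hci : ∀ n : ℕ, Integrable (fun x => clip n (h x)) ν := fun n =>
    Integrable.of_bound (C := n) (hcm n).aestronglyMeasurable
      (ae_of_all _ fun x => abs_clip_le n.cast_nonneg _)
  have hyi : ∀ᶠ i in U, ∀ R, 0 ≤ R → Integrable (fun ω => clip R (Y i ω)) (P i) := by
    filter_upwards [hY] with i hi R hR
    exact hi.1.mono ((continuous_clip R).comp_aestronglyMeasurable hi.1.1)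
      (ae_of_all _ fun ω => abs_clip_le_abs hR _)
  have habs : ∀ n : ℕ, ∫ x, |clip n (h x)| ∂ν ≤ 1 + M := fun n => by
    refine le_of_tendsto (hclip' n n.cast_nonneg) ?_
    filter_upwards [hY, hyi] with i hi hci'
    calc ∫ ω, |clip n (Y i ω)| ∂(P i) ≤ ∫ ω, (1 + Y i ω ^ 2) ∂(P i) := by
          refine integral_mono (hci' n n.cast_nonneg).abs ((integrable_const _).add hi.2.2.1)
            fun ω => (abs_clip_le_abs n.cast_nonneg _).trans ?_
          nlinarith [sq_nonneg (|Y i ω| - 1), sq_abs (Y i ω), abs_nonneg (Y i ω)]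
      _ = 1 + M := by
          rw [integral_add (integrable_const _) hi.2.2.1, hi.2.2.2]
          simp
  have hint : Integrable h ν := by
    refine ⟨hh.aestronglyMeasurable, ?_⟩
    have hle : ∫⁻ x, ‖h x‖ₑ ∂ν ≤ ENNReal.ofReal (1 + M) := by
      calc ∫⁻ x, ‖h x‖ₑ ∂ν = ∫⁻ x, liminf (fun n : ℕ => ‖clip n (h x)‖ₑ) atTop ∂ν :=
            lintegral_congr fun x => ((hclim x).enorm.liminf_eq).symm
        _ ≤ liminf (fun n : ℕ => ∫⁻ x, ‖clip n (h x)‖ₑ ∂ν) atTop :=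
            lintegral_liminf_le fun n => (hcm n).enorm
        _ ≤ ENNReal.ofReal (1 + M) := by
            refine liminf_le_of_frequently_le' (Frequently.of_forall fun n => ?_)
            rw [← ofReal_integral_norm_eq_lintegral_enorm (hci n)]
            exact ENNReal.ofReal_le_ofReal (habs n)
    exact hle.trans_lt ENNReal.ofReal_lt_top
  have hdct : Tendsto (fun n : ℕ => ∫ x, clip n (h x) ∂ν) atTop (𝓝 (∫ x, h x ∂ν)) :=
    tendsto_integral_of_dominated_convergence (fun x => |h x|)
      (fun n => (hcm n).aestronglyMeasurable) hint.abs
      (fun n => ae_of_all _ fun x => abs_clip_le_abs n.cast_nonneg _)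
      (ae_of_all _ hclim)
  have hbound : ∀ n : ℕ, 0 < n → |∫ x, clip n (h x) ∂ν - m| ≤ M / n := fun n hn => by
    have hn' : (0 : ℝ) < n := by exact_mod_cast hn
    refine le_of_tendsto ((hclip n hn'.le).sub_const m).abs ?_
    filter_upwards [hY, hyi] with i hi hci'
    rw [← hi.2.1, ← integral_sub (hci' n hn'.le) hi.1, ← hi.2.2.2, ← integral_div]
    refine abs_integral_le_integral_abs.trans ?_
    refine integral_mono ((hci' n hn'.le).sub hi.1).abs (hi.2.2.1.div_const _) fun ω => ?_
    dsimp only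
    rw [le_div_iff₀ hn', mul_comm, abs_sub_comm]
    exact mul_abs_sub_clip_le hn'.le _
  have hzero : Tendsto (fun n : ℕ => |∫ x, clip n (h x) ∂ν - m|) atTop (𝓝 0) :=
    squeeze_zero' (Eventually.of_forall fun _ => abs_nonneg _)
      ((eventually_gt_atTop 0).mono hbound) (tendsto_const_div_atTop_nhds_zero_nat M)
  have h1 := tendsto_nhds_unique hzero (hdct.sub_const m).abs
  linarith [abs_eq_zero.1 h1.symm]


namespace HilbSeminorm

variable {V : Type*} [AddCommGroup V] [Module ℝ V]

theorem bilin_eq_zero_of_self_eq_zero (q : HilbSeminorm V) {n : V} (hn : q.bilin n n = 0) (v : V) :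
    q.bilin n v = 0 := by
  have h := LinearMap.BilinForm.apply_sq_le_of_symm q.bilin q.nonneg
    ⟨fun x y => q.symm x y⟩ n v
  rw [hn, zero_mul] at h
  exact pow_eq_zero_iff two_ne_zero |>.1 (le_antisymm h (sq_nonneg _))

/-- Gram-Schmidt orthonormalization for a positive semidefinite form. -/
theorem exists_isONS_span (q : HilbSeminorm V) (E : Finset V) :
    ∃ e N : Finset V, q.IsONS e ∧ (∀ n ∈ N, q.bilin n n = 0) ∧
      (∀ x ∈ e, x ∈ Submodule.span ℝ (E : Set V)) ∧ (∀ x ∈ N, x ∈ Submodule.span ℝ (E : Set V)) ∧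
      ∀ v ∈ E, v ∈ Submodule.span ℝ (e : Set V) ⊔ Submodule.span ℝ (N : Set V) := by
  classical
  induction E using Finset.induction_on with
  | empty => exact ⟨∅, ∅, ⟨by simp, by simp⟩, by simp, by simp, by simp, by simp⟩
  | insert v E hv ih =>
    obtain ⟨e, N, he, hN, heE, hNE, hE⟩ := ih
    have hmono : Submodule.span ℝ (E : Set V) ≤ Submodule.span ℝ ((insert v E : Finset V) : Set V) :=
      Submodule.span_mono (by simp)
    set p := ∑ x ∈ e, q.bilin x v • x with hp
    have hpe : p ∈ Submodule.span ℝ (e : Set V) :=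
      Submodule.sum_mem _ fun x hx => Submodule.smul_mem _ _ (Submodule.subset_span hx)
    have hpE : p ∈ Submodule.span ℝ ((insert v E : Finset V) : Set V) :=
      Submodule.sum_mem _ fun x hx => Submodule.smul_mem _ _ (hmono (heE x hx))
    obtain ⟨u, hup⟩ : ∃ u, v = p + u := ⟨v - p, (add_sub_cancel p v).symm⟩
    have huE : u ∈ Submodule.span ℝ ((insert v E : Finset V) : Set V) := by
      rw [show u = v - p by rw [hup, add_sub_cancel_left]]
      exact Submodule.sub_mem _ (Submodule.subset_span (by simp)) hpE
    have horth : ∀ x ∈ e, q.bilin x u = 0 := fun x hx => by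
      rw [show u = v - p by rw [hup, add_sub_cancel_left], map_sub, hp, map_sum, Finset.sum_eq_single x]
      · simp [he.1 x hx]
      · intro y hy hyx
        simp [he.2 x hx y hy hyx.symm]
      · exact fun h => absurd hx h
    by_cases hu : q.bilin u u = 0
    · refine ⟨e, insert u N, he, ?_, fun x hx => hmono (heE x hx), ?_, ?_⟩
      · rw [Finset.forall_mem_insert]
        exact ⟨hu, hN⟩
      · rw [Finset.forall_mem_insert]
        exact ⟨huE, fun x hx => hmono (hNE x hx)⟩
      · have hle : Submodule.span ℝ (N : Set V) ≤
            Submodule.span ℝ ((insert u N : Finset V) : Set V) :=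
          Submodule.span_mono (by simp)
        rw [Finset.forall_mem_insert]
        refine ⟨?_, fun w hw => sup_le_sup_left hle _ (hE w hw)⟩
        rw [hup]
        exact Submodule.add_mem_sup hpe (Submodule.subset_span (by simp))
    · have hpos : 0 < q.bilin u u := lt_of_le_of_ne (q.nonneg _) (Ne.symm hu)
      set s := Real.sqrt (q.bilin u u) with hs
      have hs0 : s ≠ 0 := (Real.sqrt_pos.2 hpos).ne'
      have hss : s * s = q.bilin u u := Real.mul_self_sqrt hpos.le
      refine ⟨insert (s⁻¹ • u) e, N, ⟨?_, ?_⟩, hN, ?_, fun x hx => hmono (hNE x hx), ?_⟩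
      · rw [Finset.forall_mem_insert]
        refine ⟨?_, he.1⟩
        rw [map_smul, map_smul, LinearMap.smul_apply, ← hss]
        simp only [smul_eq_mul]
        field_simp
      · intro x hx y hy hxy
        rw [Finset.mem_insert] at hx hy
        rcases hx with rfl | hx <;> rcases hy with rfl | hy
        · exact absurd rfl hxy
        · rw [q.symm, map_smul, horth y hy, smul_zero]
        · rw [map_smul, horth x hx, smul_zero]
        · exact he.2 x hx y hy hxy
      · rw [Finset.forall_mem_insert]
        exact ⟨Submodule.smul_mem _ _ huE, fun x hx => hmono (heE x hx)⟩
      · have hle : Submodule.span ℝ (e : Set V) ≤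
            Submodule.span ℝ ((insert (s⁻¹ • u) e : Finset V) : Set V) :=
          Submodule.span_mono (by simp)
        rw [Finset.forall_mem_insert]
        refine ⟨?_, fun w hw => sup_le_sup_right hle _ (hE w hw)⟩
        refine Submodule.mem_sup_left ?_
        have hsu : s • s⁻¹ • u ∈ Submodule.span ℝ ((insert (s⁻¹ • u) e : Finset V) : Set V) :=
          Submodule.smul_mem _ _ (Submodule.subset_span (by simp))
        rw [smul_inv_smul₀ hs0] at hsu
        rw [hup]
        exact Submodule.add_mem _ (hle hpe) hsu

/-- A functional vanishing on `N ⊆ ker q` is bounded on the span of `e ∪ N`, for an orthonormal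
set `e`, by the Hilbert-Schmidt norm of its restriction to `e`. -/
theorem abs_le_mul_toFun_of_isONS (q : HilbSeminorm V) {e N : Finset V} (he : q.IsONS e)
    (hN : ∀ n ∈ N, q.bilin n n = 0) (l : V →ₗ[ℝ] ℝ) (hl : ∀ n ∈ N, l n = 0) {C : ℝ} (hC : 0 ≤ C)
    (hle : ∑ x ∈ e, l x ^ 2 ≤ C ^ 2) {v : V}
    (hv : v ∈ Submodule.span ℝ (e : Set V) ⊔ Submodule.span ℝ (N : Set V)) :
    |l v| ≤ C * q.toFun v := by
  obtain ⟨x, hx, n, hn, rfl⟩ := Submodule.mem_sup.1 hv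
  have hln : l n = 0 := by
    have : Submodule.span ℝ (N : Set V) ≤ LinearMap.ker l := Submodule.span_le.2 hl
    exact this hn
  have hqn : ∀ w, q.bilin w n = 0 := fun w => by
    have : Submodule.span ℝ (N : Set V) ≤ LinearMap.ker (q.bilin w) := Submodule.span_le.2
      fun m hm => (q.symm w m).trans (q.bilin_eq_zero_of_self_eq_zero (hN m hm) w)
    exact this hn
  obtain ⟨c, -, rfl⟩ := Submodule.mem_span_finset.1 hx
  have hq : q.bilin (∑ a ∈ e, c a • a + n) (∑ a ∈ e, c a • a + n) = ∑ a ∈ e, c a ^ 2 := by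
    rw [map_add _ (∑ a ∈ e, c a • a) n, hqn, add_zero, q.symm, map_add, hqn, add_zero, map_sum]
    refine Finset.sum_congr rfl fun a ha => ?_
    rw [map_smul, map_sum, LinearMap.sum_apply, Finset.sum_eq_single a]
    · simp [he.1 a ha, sq]
    · intro b hb hba
      simp [he.2 b hb a ha hba]
    · exact fun h => absurd ha h
  have hlv : l (∑ a ∈ e, c a • a + n) = ∑ a ∈ e, c a * l a := by
    simp [hln]
  rw [toFun, hq, hlv]
  refine abs_le_of_sq_le_sq ?_ (mul_nonneg hC (Real.sqrt_nonneg _))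
  rw [mul_pow, Real.sq_sqrt (Finset.sum_nonneg fun _ _ => sq_nonneg _)]
  calc (∑ a ∈ e, c a * l a) ^ 2 ≤ (∑ a ∈ e, c a ^ 2) * ∑ a ∈ e, l a ^ 2 :=
        Finset.sum_mul_sq_le_sq_mul_sq _ _ _
    _ ≤ (∑ a ∈ e, c a ^ 2) * C ^ 2 := by gcongr
    _ = C ^ 2 * ∑ a ∈ e, c a ^ 2 := mul_comm _ _

theorem sum_bilin_le_trace_toReal {p q : HilbSeminorm V} (h : p.trace q < ⊤) {e : Finset V}
    (he : q.IsONS e) : ∑ x ∈ e, p.bilin x x ≤ (p.trace q).toReal := by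
  rw [← ENNReal.ofReal_le_iff_le_toReal h.ne]
  have hker : ∀ v, q.bilin v v = 0 → p.bilin v v = 0 := by
    by_contra hcon
    simp [trace, hcon] at h
  rw [trace, if_pos hker]
  exact le_iSup₂_of_le e he le_rfl

theorem bilin_eq_zero_of_trace_lt_top {p q : HilbSeminorm V} (h : p.trace q < ⊤) {v : V}
    (hv : q.bilin v v = 0) : p.bilin v v = 0 := by
  by_contra hcon
  have : ¬ ∀ v, q.bilin v v = 0 → p.bilin v v = 0 := fun h' => hcon (h' v hv)
  simp [trace, this] at h

end HilbSeminorm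

section CharacterSpace

variable {A : Type*} [CommRing A] [Algebra ℝ A]

instance Character.instBorelSpace : BorelSpace (Character A) := ⟨rfl⟩

theorem Character.continuous_eval (a : A) : Continuous fun α : Character A => α a :=
  (continuous_apply a).comp continuous_induced_dom

/-- The embedding of the character space into a product of extended real lines. -/
noncomputable def Character.toEReal (α : Character A) (a : A) : EReal := (α a : EReal)

theorem Character.isEmbedding_toEReal : IsEmbedding (Character.toEReal (A := A)) := by
  have h1 : IsEmbedding fun (α : Character A) (a : A) => α a :=
    ⟨⟨rfl⟩, DFunLike.coe_injective⟩
  have h2 : IsEmbedding (Pi.map fun (_ : A) (x : ℝ) => (x : EReal)) :=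
    IsEmbedding.piMap fun _ => EReal.isEmbedding_coe
  exact h2.comp h1

/-- The characters in `K_Q` whose restriction to `V` is `q`-bounded with constant `C`. -/
def boundedCharacters (V : Submodule ℝ A) (Q : Set A) (q : V → ℝ) (C : ℝ) : Set (Character A) :=
  {α | α ∈ charNonneg Q ∧ ∀ v : V, |α (v : A)| ≤ C * q v}

/-- Functions on `A` that are eventually compatible with each algebra operation and bounded on `V`
converge along an ultrafilter to a bounded character. -/
theorem exists_tendsto_boundedCharacters {ι : Type*} (U : Ultrafilter ι) {V : Submodule ℝ A}
    (hgen : Algebra.adjoin ℝ (V : Set A) = ⊤) (Q : Set A) (q : V → ℝ) (C : ℝ) (x : ι → A → ℝ)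
    (hconst : ∀ r : ℝ, ∀ᶠ i in U, x i (algebraMap ℝ A r) = r)
    (hadd : ∀ a b, ∀ᶠ i in U, x i (a + b) = x i a + x i b)
    (hmul : ∀ a b, ∀ᶠ i in U, x i (a * b) = x i a * x i b)
    (hQ : ∀ a ∈ Q, ∀ᶠ i in U, 0 ≤ x i a)
    (hV : ∀ v : V, ∀ᶠ i in U, |x i v| ≤ C * q v) :
    ∃ α ∈ boundedCharacters V Q q C, ∀ a, Tendsto (fun i => x i a) U (𝓝 (α a)) := by
  have hbd : ∀ a : A, ∃ r : ℝ, ∀ᶠ i in U, |x i a| ≤ r := by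
    intro a
    have ha : a ∈ Algebra.adjoin ℝ (V : Set A) := hgen ▸ Algebra.mem_top
    induction ha using Algebra.adjoin_induction with
    | mem v hv => exact ⟨C * q ⟨v, hv⟩, hV ⟨v, hv⟩⟩
    | algebraMap r => exact ⟨|r|, (hconst r).mono fun i hi => by rw [hi]⟩
    | add a b _ _ iha ihb =>
      obtain ⟨r, hr⟩ := iha
      obtain ⟨s, hs⟩ := ihb
      refine ⟨r + s, ?_⟩
      filter_upwards [hr, hs, hadd a b] with i h1 h2 h3
      rw [h3]
      exact (abs_add_le _ _).trans (add_le_add h1 h2)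
    | mul a b _ _ iha ihb =>
      obtain ⟨r, hr⟩ := iha
      obtain ⟨s, hs⟩ := ihb
      refine ⟨r * s, ?_⟩
      filter_upwards [hr, hs, hmul a b] with i h1 h2 h3
      rw [h3, abs_mul]
      exact mul_le_mul h1 h2 (abs_nonneg _) ((abs_nonneg _).trans h1)
  have hlim : ∀ a : A, ∃ y : ℝ, Tendsto (fun i => x i a) U (𝓝 y) := by
    intro a
    obtain ⟨r, hr⟩ := hbd a
    obtain ⟨y, -, hy⟩ := (isCompact_Icc (a := -r) (b := r)).ultrafilter_le_nhds'
      (U.map fun i => x i a) (hr.mono fun i hi => abs_le.1 hi)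
    exact ⟨y, hy⟩
  choose y hy using hlim
  have hyadd : ∀ a b, y (a + b) = y a + y b := fun a b =>
    tendsto_nhds_unique (hy (a + b)) (((hy a).add (hy b)).congr' ((hadd a b).mono fun i h => h.symm))
  have hymul : ∀ a b, y (a * b) = y a * y b := fun a b =>
    tendsto_nhds_unique (hy (a * b)) (((hy a).mul (hy b)).congr' ((hmul a b).mono fun i h => h.symm))
  have hyconst : ∀ r : ℝ, y (algebraMap ℝ A r) = r := fun r =>
    tendsto_nhds_unique (hy _) (tendsto_const_nhds.congr' ((hconst r).mono fun i h => h.symm))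
  let α : Character A :=
    { toFun := y
      map_one' := by simpa using hyconst 1
      map_mul' := hymul
      map_zero' := by simpa using hyconst 0
      map_add' := hyadd
      commutes' := hyconst }
  refine ⟨α, ⟨fun a ha => ?_, fun v => ?_⟩, hy⟩
  · exact ge_of_tendsto (hy a) (hQ a ha)
  · exact le_of_tendsto (hy v).abs (hV v)

theorem isCompact_boundedCharacters {V : Submodule ℝ A}
    (hgen : Algebra.adjoin ℝ (V : Set A) = ⊤) (Q : Set A) (q : V → ℝ) (C : ℝ) :
    IsCompact (boundedCharacters V Q q C) := by
  refine isCompact_iff_ultrafilter_le_nhds'.2 fun U hU => ?_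
  obtain ⟨α, hα, hlim⟩ := exists_tendsto_boundedCharacters U hgen Q q C (fun β a => β a)
    (fun r => Eventually.of_forall fun β => AlgHomClass.commutes β r)
    (fun a b => Eventually.of_forall fun β => map_add β a b)
    (fun a b => Eventually.of_forall fun β => map_mul β a b)
    (fun a ha => mem_of_superset hU fun β hβ => hβ.1 a ha)
    (fun v => mem_of_superset hU fun β hβ => hβ.2 v)
  refine ⟨α, hα, ?_⟩
  rw [nhds_induced, ← tendsto_iff_comap]
  exact tendsto_pi_nhds.2 hlim

/-- A probability measure representing a linear functional integrates every evaluation: otherwise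
both `a` and `a + 1` would have vanishing Bochner integrals. -/
theorem integrable_eval_of_represents (l : A →ₗ[ℝ] ℝ) (h1 : l 1 = 1) (P : Measure (Character A))
    [IsFiniteMeasure P] (hP : ∀ a, l a = ∫ α : Character A, α a ∂P) (a : A) :
    Integrable (fun α : Character A => α a) P := by
  by_contra h
  have h' : ¬ Integrable (fun α : Character A => α (a + 1)) P := fun h' => h <| by
    refine (h'.sub (integrable_const (1 : ℝ))).congr (ae_of_all _ fun α => ?_)
    simp
  have e := hP (a + 1)
  rw [integral_undef h', map_add, hP a, integral_undef h, h1] at e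
  norm_num at e

end CharacterSpace

section FiniteSubspaces

variable {A : Type*} [CommRing A] [Algebra ℝ A] (V : Submodule ℝ A)

/-- The subalgebra generated by the span of a finite subset of `V`. -/
def finSubalgebra (E : Finset V) : Subalgebra ℝ A :=
  Algebra.adjoin ℝ (((Submodule.span ℝ (E : Set V)).map V.subtype : Submodule ℝ A) : Set A)

theorem finSubalgebra_mem (E : Finset V) : finSubalgebra V E ∈ finGenSubalgebras V :=
  ⟨_, Submodule.map_subtype_le V _, inferInstance, rfl⟩

variable {V}

theorem mem_finSubalgebra {E : Finset V} {v : V} (hv : v ∈ Submodule.span ℝ (E : Set V)) :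
    (v : A) ∈ finSubalgebra V E :=
  Algebra.subset_adjoin ⟨v, hv, rfl⟩

theorem eventually_mem_finSubalgebra (hgen : Algebra.adjoin ℝ (V : Set A) = ⊤) (a : A) :
    ∀ᶠ E : Finset V in atTop, a ∈ finSubalgebra V E := by
  have ha : a ∈ Algebra.adjoin ℝ (V : Set A) := hgen ▸ Algebra.mem_top
  induction ha using Algebra.adjoin_induction with
  | mem v hv =>
    filter_upwards [eventually_ge_atTop {⟨v, hv⟩}] with E hE
    exact mem_finSubalgebra (v := ⟨v, hv⟩) (Submodule.subset_span (hE (Finset.mem_singleton_self _)))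
  | algebraMap r => exact Eventually.of_forall fun E => Subalgebra.algebraMap_mem _ r
  | add a b _ _ iha ihb =>
    filter_upwards [iha, ihb] with E h1 h2 using add_mem h1 h2
  | mul a b _ _ iha ihb =>
    filter_upwards [iha, ihb] with E h1 h2 using mul_mem h1 h2

open scoped Classical in
/-- The extension by zero to `A` of a character of a subalgebra. -/
noncomputable def Character.extend {S : Subalgebra ℝ A} (α : Character S) (a : A) : ℝ :=
  if h : a ∈ S then α ⟨a, h⟩ else 0

theorem Character.extend_of_mem {S : Subalgebra ℝ A} (α : Character S) {a : A} (h : a ∈ S) :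
    α.extend a = α ⟨a, h⟩ := dif_pos h

theorem Character.continuous_extend {S : Subalgebra ℝ A} (a : A) :
    Continuous fun α : Character S => α.extend a := by
  by_cases h : a ∈ S
  · simp only [extend_of_mem _ h]
    exact Character.continuous_eval _
  · simp only [extend, dif_neg h]
    exact continuous_const

/-- The characters of a finitely generated subalgebra that lie in `K_{Q ∩ S}` and are bounded on
the generators. -/
def boundedCharactersOn (Q : Set A) (q : V → ℝ) (C : ℝ) (E : Finset V) :
    Set (Character (finSubalgebra V E)) :=
  {α | α ∈ charNonnegOn Q (finSubalgebra V E) ∧ ∀ v ∈ E, |α.extend (v : A)| ≤ C * q v}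

theorem exists_tendsto_extend (U : Ultrafilter (Finset V)) (hU : (U : Filter (Finset V)) ≤ atTop)
    (hgen : Algebra.adjoin ℝ (V : Set A) = ⊤) (Q : Set A) (q : V → ℝ) (C : ℝ)
    (α : ∀ E, Character (finSubalgebra V E))
    (hα : ∀ᶠ E in U, α E ∈ boundedCharactersOn Q q C E) :
    ∃ β ∈ boundedCharacters V Q q C, ∀ a, Tendsto (fun E => (α E).extend a) U (𝓝 (β a)) := by
  have hmem : ∀ a, ∀ᶠ E in U, a ∈ finSubalgebra V E := fun a =>
    hU (eventually_mem_finSubalgebra hgen a)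
  refine exists_tendsto_boundedCharacters U hgen Q q C (fun E => (α E).extend) ?_ ?_ ?_ ?_ ?_
  · refine fun r => Eventually.of_forall fun E => ?_
    rw [Character.extend_of_mem _ (Subalgebra.algebraMap_mem _ r)]
    exact AlgHomClass.commutes (α E) r
  · intro a b
    filter_upwards [hmem a, hmem b] with E ha hb
    rw [Character.extend_of_mem _ ha, Character.extend_of_mem _ hb,
      Character.extend_of_mem _ (add_mem ha hb), ← map_add]
    rfl
  · intro a b
    filter_upwards [hmem a, hmem b] with E ha hb
    rw [Character.extend_of_mem _ ha, Character.extend_of_mem _ hb,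
      Character.extend_of_mem _ (mul_mem ha hb), ← map_mul]
    rfl
  · intro a ha
    filter_upwards [hmem a, hα] with E haE hE
    rw [Character.extend_of_mem _ haE]
    exact hE.1 _ ha
  · intro v
    filter_upwards [hα, hU (eventually_ge_atTop {v})] with E hE hv
    exact hE.2 v (hv (Finset.mem_singleton_self v))

/-- Chebyshev's inequality: a finite trace concentrates representing measures on bounded
characters. -/
theorem measure_compl_boundedCharactersOn_le (L : A →ₗ[ℝ] ℝ) (hL1 : L 1 = 1)
    (hLsq : ∀ a : A, 0 ≤ L (a * a)) (Q : Set A) (q : HilbSeminorm V)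
    (htr : ((sLSeminorm L hLsq).comp V.subtype).trace q < ⊤) (E : Finset V)
    (P : Measure (Character (finSubalgebra V E))) [IsProbabilityMeasure P]
    (hP : ∀ a : finSubalgebra V E, L (a : A) = ∫ α : Character (finSubalgebra V E), α a ∂P)
    (hPQ : P {α | α ∉ charNonnegOn Q (finSubalgebra V E)} = 0) {C : ℝ} (hC : 0 < C) :
    P (boundedCharactersOn Q q.toFun C E)ᶜ ≤
      ENNReal.ofReal ((((sLSeminorm L hLsq).comp V.subtype).trace q).toReal / C ^ 2) := by
  set t := (((sLSeminorm L hLsq).comp V.subtype).trace q).toReal with ht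
  obtain ⟨e, N, he, hN, heE, hNE, hE⟩ := q.exists_isONS_span E
  have hsq : ∀ v ∈ Submodule.span ℝ (E : Set V),
      Integrable (fun α : Character (finSubalgebra V E) => α.extend (v : A) ^ 2) P ∧
        ∫ α : Character (finSubalgebra V E), α.extend (v : A) ^ 2 ∂P = L (v * v) := by
    intro v hv
    have hvS : (v : A) ∈ finSubalgebra V E := mem_finSubalgebra hv
    have heq : ∀ α : Character (finSubalgebra V E), α.extend (v : A) ^ 2 = α (⟨v, hvS⟩ * ⟨v, hvS⟩) := fun α => by
      rw [Character.extend_of_mem _ hvS, map_mul, sq]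
    simp only [heq]
    exact ⟨integrable_eval_of_represents (L.comp (finSubalgebra V E).val.toLinearMap) hL1 P hP _, (hP _).symm⟩
  have hNnull : ∀ᵐ α ∂P, ∀ n ∈ N, α.extend (n : A) = 0 := by
    rw [Finset.eventually_all]
    intro n hn
    obtain ⟨hi, hint⟩ := hsq n (hNE n hn)
    have h0 : L ((n : A) * n) = 0 := HilbSeminorm.bilin_eq_zero_of_trace_lt_top htr (hN n hn)
    rw [h0, integral_eq_zero_iff_of_nonneg (fun α => sq_nonneg _) hi] at hint
    filter_upwards [hint] with α hα
    exact pow_eq_zero_iff two_ne_zero |>.1 hα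
  have hint : Integrable (fun α : Character (finSubalgebra V E) => ∑ x ∈ e, α.extend (x : A) ^ 2) P :=
    integrable_finsetSum _ fun x hx => (hsq x (heE x hx)).1
  have hintle : ∫ α : Character (finSubalgebra V E), ∑ x ∈ e, α.extend (x : A) ^ 2 ∂P ≤ t := by
    rw [integral_finsetSum _ fun x hx => (hsq x (heE x hx)).1]
    refine le_trans (le_of_eq ?_) (HilbSeminorm.sum_bilin_le_trace_toReal htr he)
    exact Finset.sum_congr rfl fun x hx => (hsq x (heE x hx)).2
  have hmarkov : P {α : Character (finSubalgebra V E) | C ^ 2 ≤ ∑ x ∈ e, α.extend (x : A) ^ 2} ≤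
      ENNReal.ofReal (t / C ^ 2) := by
    rw [← ofReal_measureReal]
    refine ENNReal.ofReal_le_ofReal ?_
    rw [le_div_iff₀ (by positivity), mul_comm]
    exact (mul_meas_ge_le_integral_of_nonneg
      (ae_of_all _ fun α => Finset.sum_nonneg fun _ _ => sq_nonneg _) hint _).trans hintle
  refine le_trans (measure_mono_ae ?_) hmarkov
  have hQae : ∀ᵐ α ∂P, α ∈ charNonnegOn Q (finSubalgebra V E) := hPQ
  filter_upwards [hNnull, hQae] with α hαN hαQ hαG
  by_contra hsum
  refine hαG ⟨hαQ, fun v hv => ?_⟩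
  have hvspan : ∀ w ∈ Submodule.span ℝ (E : Set V), (w : A) ∈ finSubalgebra V E := fun w hw => mem_finSubalgebra hw
  let l₀ : Submodule.span ℝ (E : Set V) →ₗ[ℝ] ℝ :=
    { toFun := fun w => α ⟨(w : V), hvspan w w.2⟩
      map_add' := fun w w' => by
        rw [← map_add]
        rfl
      map_smul' := fun c w => by
        rw [RingHom.id_apply, ← map_smul]
        rfl }
  obtain ⟨l, hl⟩ := LinearMap.exists_extend l₀
  have hlα : ∀ w ∈ Submodule.span ℝ (E : Set V), l w = α.extend (w : A) := fun w hw => by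
    rw [Character.extend_of_mem _ (hvspan w hw)]
    exact LinearMap.congr_fun hl ⟨w, hw⟩
  rw [← hlα v (Submodule.subset_span hv)]
  refine q.abs_le_mul_toFun_of_isONS he hN l
    (fun n hn => (hlα n (hNE n hn)).trans (hαN n hn)) hC.le ?_ (hE v hv)
  rw [Finset.sum_congr rfl fun x hx => by rw [hlα x (heE x hx)]]
  exact (not_le.1 hsum).le

end FiniteSubspaces
/-- Corollary `theorem-main-s_L`: existence of a representing measure
from `tr(s_L|_V / q) < ∞` and representing measures on the finitely generated
subalgebras. -/
theorem statement5 {A : Type*} [CommRing A] [Algebra ℝ A]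
    (V : Submodule ℝ A) (hgen : Algebra.adjoin ℝ (V : Set A) = ⊤)
    (L : A →ₗ[ℝ] ℝ) (hL1 : L 1 = 1) (hLsq : ∀ a : A, 0 ≤ L (a * a))
    (Q : Set A) (hQ : IsQuadraticModule Q)
    (q : HilbSeminorm ↥V)
    (htr : ((sLSeminorm L hLsq).comp V.subtype).trace q < ⊤)
    (hT : ∃ α : Character A, α ∈ charNonneg Q ∧ QContOn V q.toFun α)
    (ν : ∀ S : Subalgebra ℝ A, Measure (Character ↥S))
    (hν : ∀ S ∈ finGenSubalgebras V, IsRadonMeasure (ν S) ∧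
      (∀ a : S, L (a : A) = ∫ α : Character ↥S, α a ∂(ν S)) ∧
      ν S {α : Character ↥S | α ∉ charNonnegOn Q S} = 0) :
    ∃ ν' : Measure (Character A), IsRadonMeasure ν' ∧
      (∀ a : A, L a = ∫ α : Character A, α a ∂ν') ∧
      ν' {α : Character A | ¬ (α ∈ charNonneg Q ∧ QContOn V q.toFun α)} = 0 := by

  obtain ⟨α₀, -⟩ := hT
  have : Nonempty (Character A) := ⟨α₀⟩
  have hP : ∀ E : Finset V, IsProbabilityMeasure (ν (finSubalgebra V E)) := fun E => by
    have h := (hν _ (finSubalgebra_mem V E)).2.1 1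
    simp only [map_one, OneMemClass.coe_one, hL1, integral_const, smul_eq_mul, mul_one] at h
    exact ⟨(ENNReal.toReal_eq_one_iff _).1 h.symm⟩
  let _ : MeasurableSpace (A → EReal) := borel _
  have : BorelSpace (A → EReal) := ⟨rfl⟩
  let U : Ultrafilter (Finset V) := Ultrafilter.of atTop
  have hU : (U : Filter (Finset V)) ≤ atTop := Ultrafilter.of_le _
  let Y : ∀ E : Finset V, Character (finSubalgebra V E) → A → EReal :=
    fun E α a => (α.extend a : EReal)
  have hY : ∀ E, Continuous (Y E) := fun E => continuous_pi fun a =>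
    continuous_coe_real_ereal.comp (Character.continuous_extend a)
  obtain ⟨μ, hμprob, hμreg, hμ⟩ := exists_regular_ultralimit U
    (fun E => ν (finSubalgebra V E)) Y hY
  set t := (((sLSeminorm L hLsq).comp V.subtype).trace q).toReal
  have hK : ∀ n : ℕ, IsCompact (boundedCharacters V Q q.toFun ((n : ℝ) + 1)) := fun n =>
    isCompact_boundedCharacters hgen Q q.toFun _
  have hmass : ∀ n : ℕ, μ (Character.toEReal '' boundedCharacters V Q q.toFun ((n : ℝ) + 1))ᶜ ≤
      ENNReal.ofReal (t / ((n : ℝ) + 1) ^ 2) := fun n => by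
    refine measure_compl_le_of_ultralimit U (fun E => ν (finSubalgebra V E)) Y hY μ hμ
      ((hK n).image Character.isEmbedding_toEReal.continuous).isClosed
      (boundedCharactersOn Q q.toFun ((n : ℝ) + 1)) (by positivity) (fun E => ?_)
      fun α hα z hz => ?_
    · have h := hν _ (finSubalgebra_mem V E)
      exact measure_compl_boundedCharactersOn_le L hL1 hLsq Q q htr E _ h.2.1 h.2.2 (by positivity)
    · obtain ⟨β, hβ, hlim⟩ := exists_tendsto_extend U hU hgen Q q.toFun _ α hα
      refine ⟨β, hβ, tendsto_nhds_unique (tendsto_pi_nhds.2 fun a => ?_) hz⟩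
      exact EReal.tendsto_coe.2 (hlim a)
  have hε : Tendsto (fun n : ℕ => t / ((n : ℝ) + 1) ^ 2) atTop (𝓝 0) :=
    tendsto_const_nhds.div_atTop ((tendsto_pow_atTop two_ne_zero).comp
      (tendsto_atTop_add_const_right _ _ tendsto_natCast_atTop_atTop))
  obtain ⟨ν', hν'prob, hRadon, hmap, hnull⟩ := exists_isRadonMeasure_map_eq
    Character.isEmbedding_toEReal μ _ hK hε hmass
  have htransfer : ∀ (f : C(EReal, ℝ)) (a : A),
      Tendsto (fun E => ∫ α : Character (finSubalgebra V E), f (α.extend a : EReal)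
        ∂(ν (finSubalgebra V E))) U (𝓝 (∫ α : Character A, f (α a : EReal) ∂ν')) := fun f a => by
    have hf : Continuous fun z : A → EReal => f (z a) := f.continuous.comp (continuous_apply a)
    have h := hμ ⟨_, hf⟩
    simp only [ContinuousMap.coe_mk] at h
    rw [← hmap, integral_map Character.isEmbedding_toEReal.continuous.measurable.aemeasurable
      hf.measurable.aestronglyMeasurable] at h
    exact h
  refine ⟨ν', hRadon, fun a => ?_, measure_mono_null (fun α hα => ?_) hnull⟩
  · refine integral_eq_of_tendsto_integral_clip (U : Filter (Finset V))
      (fun E => ν (finSubalgebra V E)) ν' (fun α => α a)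
      (Character.continuous_eval a).measurable (fun E α => α.extend a) (L a) (L (a * a)) ?_ ?_ ?_
    · filter_upwards [hU (eventually_mem_finSubalgebra hgen a)] with E ha
      have hrep := (hν _ (finSubalgebra_mem V E)).2.1
      have hint := integrable_eval_of_represents
        (L.comp (finSubalgebra V E).val.toLinearMap) hL1 _ hrep
      have hsq : ∀ α : Character (finSubalgebra V E), α ⟨a, ha⟩ ^ 2 = α (⟨a, ha⟩ * ⟨a, ha⟩) :=
        fun α => by rw [map_mul, sq]
      simp only [Character.extend_of_mem _ ha, hsq]
      exact ⟨hint _, (hrep _).symm, hint _, (hrep _).symm⟩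
    · intro R _
      simpa only [ContinuousMap.coe_mk, ERealClip_coe] using
        htransfer ⟨ERealClip R, continuous_ERealClip R⟩ a
    · intro R _
      simpa only [ContinuousMap.coe_mk, ERealClip_coe] using
        htransfer ⟨fun x => |ERealClip R x|, (continuous_ERealClip R).abs⟩ a
  · rw [mem_compl_iff, mem_iUnion]
    rintro ⟨n, hn⟩
    exact hα ⟨hn.1, (n : ℝ) + 1, by positivity, hn.2⟩
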